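/- arXiv:1001.4674 — 4 statements merged into one kernel-verified Lean document; each statement's English description precedes it below -/
import Mathlib

section
/- Generalized Harris inequality for products of posets (Lemma 3.1): For every real p > 0 there is a constant C = C(p) > 0 such that the following holds. Let n ≥ 1, let P_1, …, P_n be finite posets each of which has a greatest element, for each i let μ_i be a probability measure on P_i assigning probability at least p to the greatest element of P_i, and let μ = μ_1 ⊗ ⋯ ⊗ μ_n be the product probability measure on the product poset P = P_1 × ⋯ × P_n (with the coordinatewise partial order). Then for any two upsets A and B in P one has μ(A ∩ B) ≥ (μ(A)·μ(B))^C. -/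
/-- A one-variable estimate: `p + (1 - p) y ^ (k + 1)` dominates an exponential that agrees with it
to first order at `y = 1`. -/
theorem exp_le_add_mul_pow {p : ℝ} (hp1 : p ≤ 1) {k : ℕ} (hk : 1 ≤ (k + 1) * p)
    {y : ℝ} (hy0 : 0 ≤ y) (hy1 : y ≤ 1) :
    Real.exp (-((k + 1) * (1 - p) * (1 - y))) ≤ p + (1 - p) * y ^ (k + 1) := by
  have hderiv : ∀ z : ℝ, HasDerivAt
      (fun z : ℝ => p + (1 - p) * z ^ (k + 1) - Real.exp (-((k + 1) * (1 - p) * (1 - z))))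
      ((k + 1) * (1 - p) * (z ^ k - Real.exp (-((k + 1) * (1 - p) * (1 - z))))) z := by
    intro z
    have h1 : HasDerivAt (fun z : ℝ => -((k + 1) * (1 - p) * (1 - z))) ((k + 1) * (1 - p)) z := by
      refine (((hasDerivAt_id' z).const_sub 1).const_mul ((k + 1) * (1 - p))).neg.congr_deriv ?_
      ring
    refine ((((hasDerivAt_pow (k + 1) z).const_mul (1 - p)).const_add p).sub
      h1.exp).congr_deriv ?_
    push_cast
    ring
  have hanti : AntitoneOn
      (fun z : ℝ => p + (1 - p) * z ^ (k + 1) - Real.exp (-((k + 1) * (1 - p) * (1 - z))))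
      (Set.Icc 0 1) := by
    refine antitoneOn_of_deriv_nonpos (convex_Icc 0 1)
      (fun z _ => (hderiv z).continuousAt.continuousWithinAt)
      (fun z _ => (hderiv z).differentiableAt.differentiableWithinAt) fun z hz => ?_
    rw [interior_Icc] at hz
    rw [(hderiv z).deriv]
    refine mul_nonpos_of_nonneg_of_nonpos (mul_nonneg (by positivity) (by linarith)) ?_
    rw [sub_nonpos]
    calc z ^ k ≤ Real.exp (-(1 - z)) ^ k :=
          pow_le_pow_left₀ hz.1.le (by linarith [Real.one_sub_le_exp_neg (1 - z)]) k
      _ = Real.exp (k * -(1 - z)) := (Real.exp_nat_mul _ k).symm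
      _ ≤ _ := Real.exp_le_exp.2 (by nlinarith [hz.2])
  have h := hanti ⟨hy0, hy1⟩ (Set.right_mem_Icc.2 zero_le_one) hy1
  simp at h
  linarith

/-- The single-factor inequality for functions normalized to attain their maximum `1` at `T`. -/
theorem pow_mul_sum_le_of_apply_eq_one {ι : Type*} [Fintype ι] {p : ℝ} (hp1 : p < 1)
    {k : ℕ} (hk : 1 ≤ (k + 1) * p) {w a b : ι → ℝ} {T : ι}
    (hw : ∀ x, 0 ≤ w x) (hw1 : ∑ x, w x = 1) (hT : p ≤ w T)
    (ha : ∀ x, 0 ≤ a x) (ha1 : ∀ x, a x ≤ 1) (haT : a T = 1)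
    (hb : ∀ x, 0 ≤ b x) (hb1 : ∀ x, b x ≤ 1) (hbT : b T = 1) :
    ((∑ x, w x * a x) * ∑ x, w x * b x) ^ (k + 1) ≤ ∑ x, w x * (a x * b x) ^ (k + 1) := by
  classical
  have hq : 0 < 1 - p := by linarith
  -- `w` is the mixture of the point mass at `T` with weight `p` and of `v` with weight `1 - p`.
  let v : ι → ℝ := fun x => (w x - if x = T then p else 0) / (1 - p)
  have hv : ∀ x, 0 ≤ v x := fun x => div_nonneg (by
    split_ifs with h
    · subst h; linarith
    · linarith [hw x]) hq.le
  have hmix : ∀ f : ι → ℝ, ∑ x, w x * f x = p * f T + (1 - p) * ∑ x, v x * f x := by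
    intro f
    have : ∀ x, (1 - p) * (v x * f x) = w x * f x - if x = T then p * f x else 0 := by
      intro x
      simp only [v]
      split_ifs
      · field_simp
      · field_simp
        ring
    rw [Finset.mul_sum, Finset.sum_congr rfl fun x _ => this x, Finset.sum_sub_distrib]
    simp
  have hv1 : ∑ x, v x = 1 := by
    have h := hmix fun _ => 1
    simp only [mul_one, hw1] at h
    exact mul_left_cancel₀ hq.ne' (by linarith)
  have hab : ∀ x, 0 ≤ a x * b x := fun x => mul_nonneg (ha x) (hb x)
  have hy0 : 0 ≤ ∑ x, v x * (a x * b x) :=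
    Finset.sum_nonneg fun x _ => mul_nonneg (hv x) (hab x)
  have hy1 : ∑ x, v x * (a x * b x) ≤ 1 := by
    rw [← hv1]
    exact Finset.sum_le_sum fun x _ =>
      mul_le_of_le_one_right (hv x) (mul_le_one₀ (ha1 x) (hb x) (hb1 x))
  have hunion : (∑ x, w x * a x) + (∑ x, w x * b x) - 1 ≤ ∑ x, w x * (a x * b x) := by
    rw [← hw1, ← Finset.sum_add_distrib, ← Finset.sum_sub_distrib]
    refine Finset.sum_le_sum fun x _ => ?_
    nlinarith [mul_nonneg (hw x) (mul_nonneg (sub_nonneg.2 (ha1 x)) (sub_nonneg.2 (hb1 x)))]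
  have hmean := hmix fun x => a x * b x
  simp only [haT, hbT, mul_one] at hmean
  have hjensen := Real.pow_arith_mean_le_arith_mean_pow Finset.univ v (fun x => a x * b x)
    (fun x _ => hv x) hv1 (fun x _ => hab x) (k + 1)
  rw [hmix fun x => (a x * b x) ^ (k + 1)]
  simp only [haT, hbT, mul_one, one_pow]
  set α := ∑ x, w x * a x
  set β := ∑ x, w x * b x
  set y := ∑ x, v x * (a x * b x)
  have hα : 0 ≤ α := Finset.sum_nonneg fun x _ => mul_nonneg (hw x) (ha x)
  have hβ : 0 ≤ β := Finset.sum_nonneg fun x _ => mul_nonneg (hw x) (hb x)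
  calc (α * β) ^ (k + 1)
      ≤ (Real.exp (-(1 - α)) * Real.exp (-(1 - β))) ^ (k + 1) := by
        gcongr
        · linarith [Real.one_sub_le_exp_neg (1 - α)]
        · linarith [Real.one_sub_le_exp_neg (1 - β)]
    _ = Real.exp ((k + 1) * (-(1 - α) + -(1 - β))) := by
        rw [← Real.exp_add, ← Real.exp_nat_mul]
        push_cast
        rfl
    _ ≤ Real.exp (-((k + 1) * (1 - p) * (1 - y))) := by
        refine Real.exp_le_exp.2 ?_
        have hs : (1 - p) * (1 - y) ≤ (1 - α) + (1 - β) := by linarith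
        nlinarith [mul_le_mul_of_nonneg_left hs (by positivity : (0 : ℝ) ≤ k + 1)]
    _ ≤ p + (1 - p) * y ^ (k + 1) := exp_le_add_mul_pow hp1.le hk hy0 hy1
    _ ≤ _ := by gcongr

/-- The single-factor inequality for nonnegative functions attaining their maximum at `T`. -/
theorem pow_mul_sum_le_of_le_apply {ι : Type*} [Fintype ι] {p : ℝ} (hp1 : p < 1)
    {k : ℕ} (hk : 1 ≤ (k + 1) * p) {w a b : ι → ℝ} {T : ι}
    (hw : ∀ x, 0 ≤ w x) (hw1 : ∑ x, w x = 1) (hT : p ≤ w T)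
    (ha : ∀ x, 0 ≤ a x) (haT : ∀ x, a x ≤ a T) (hb : ∀ x, 0 ≤ b x) (hbT : ∀ x, b x ≤ b T) :
    ((∑ x, w x * a x) * ∑ x, w x * b x) ^ (k + 1) ≤ ∑ x, w x * (a x * b x) ^ (k + 1) := by
  rcases (ha T).eq_or_lt with ha0 | ha0
  · have : ∀ x, a x = 0 := fun x => le_antisymm (ha0 ▸ haT x) (ha x)
    simp [this]
  rcases (hb T).eq_or_lt with hb0 | hb0
  · have : ∀ x, b x = 0 := fun x => le_antisymm (hb0 ▸ hbT x) (hb x)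
    simp [this]
  have h := pow_mul_sum_le_of_apply_eq_one hp1 hk (a := fun x => a x / a T)
    (b := fun x => b x / b T) hw hw1 hT (fun x => div_nonneg (ha x) ha0.le)
    (fun x => (div_le_one ha0).2 (haT x)) (div_self ha0.ne')
    (fun x => div_nonneg (hb x) hb0.le) (fun x => (div_le_one hb0).2 (hbT x)) (div_self hb0.ne')
  simp only [div_mul_div_comm, div_pow] at h
  simp only [← mul_div_assoc, ← Finset.sum_div] at h
  rw [div_mul_eq_mul_div, div_div, div_pow] at h
  exact (div_le_div_iff_of_pos_right (pow_pos (mul_pos ha0 hb0) _)).1 h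

/-- Fubini for the product weight of a set, splitting off the first coordinate. -/
theorem sum_indicator_prod_succ {n : ℕ} {P : Fin (n + 1) → Type*} [∀ i, Fintype (P i)]
    (μ : ∀ i, P i → ℝ) (A : Set (∀ i, P i)) :
    ∑ x : (∀ i, P i), A.indicator (fun y => ∏ i, μ i (y i)) x =
      ∑ t : P 0, μ 0 t * ∑ x : (∀ i : Fin n, P i.succ),
        {y : ∀ i : Fin n, P i.succ | (Fin.cons t y : ∀ i, P i) ∈ A}.indicator
          (fun y => ∏ i, μ i.succ (y i)) x := by
  classical
  rw [← (Fin.consEquiv P).sum_comp, Fintype.sum_prod_type]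
  refine Finset.sum_congr rfl fun t _ => ?_
  rw [Finset.mul_sum]
  refine Finset.sum_congr rfl fun x _ => ?_
  simp [Set.indicator_apply, Fin.consEquiv, Fin.prod_univ_succ]

/-- The generalized Harris inequality with a natural number exponent. -/
theorem pow_mul_le_sum_indicator_inter {p : ℝ} (hp1 : p < 1) {k : ℕ} (hk : 1 ≤ (k + 1) * p)
    {n : ℕ} {P : Fin n → Type*} [∀ i, Fintype (P i)] [∀ i, PartialOrder (P i)]
    {μ : ∀ i, P i → ℝ} {T : ∀ i, P i} (hμ : ∀ i x, 0 ≤ μ i x) (hμ1 : ∀ i, ∑ x, μ i x = 1)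
    (hT : ∀ i x, x ≤ T i) (hp : ∀ i, p ≤ μ i (T i)) {A B : Set (∀ i, P i)}
    (hA : IsUpperSet A) (hB : IsUpperSet B) :
    ((∑ x : (∀ i, P i), A.indicator (fun y => ∏ i, μ i (y i)) x) *
      ∑ x : (∀ i, P i), B.indicator (fun y => ∏ i, μ i (y i)) x) ^ (k + 1) ≤
      ∑ x : (∀ i, P i), (A ∩ B).indicator (fun y => ∏ i, μ i (y i)) x := by
  classical
  induction n with
  | zero =>
    simp only [Fintype.sum_unique, Set.indicator_apply, Set.mem_inter_iff]
    by_cases h1 : (default : ∀ i, P i) ∈ A <;> by_cases h2 : (default : ∀ i, P i) ∈ B <;>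
      simp [h1, h2]
  | succ n ih =>
    have hprod : ∀ y : ∀ i : Fin n, P i.succ, 0 ≤ ∏ i, μ i.succ (y i) :=
      fun y => Finset.prod_nonneg fun i _ => hμ _ _
    have hnonneg : ∀ S : Set (∀ i : Fin n, P i.succ),
        0 ≤ ∑ x, S.indicator (fun y => ∏ i, μ i.succ (y i)) x :=
      fun S => Finset.sum_nonneg fun x _ => Set.indicator_nonneg (fun y _ => hprod y) x
    have hmono : ∀ {S : Set (∀ i, P i)}, IsUpperSet S → ∀ t : P 0,
        ∑ x, {y : ∀ i : Fin n, P i.succ | (Fin.cons t y : ∀ i, P i) ∈ S}.indicator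
          (fun y => ∏ i, μ i.succ (y i)) x ≤
        ∑ x, {y : ∀ i : Fin n, P i.succ | (Fin.cons (T 0) y : ∀ i, P i) ∈ S}.indicator
          (fun y => ∏ i, μ i.succ (y i)) x := fun hS t =>
      Finset.sum_le_sum fun x _ => Set.indicator_le_indicator_apply_of_subset
        (fun y hy => hS (Fin.cons_le_cons.2 ⟨hT 0 t, le_rfl⟩) hy) (hprod x)
    have hsection : ∀ {S : Set (∀ i, P i)}, IsUpperSet S → ∀ t : P 0,
        IsUpperSet {y : ∀ i : Fin n, P i.succ | (Fin.cons t y : ∀ i, P i) ∈ S} :=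
      fun hS t y z hyz hy => hS (Fin.cons_le_cons.2 ⟨le_rfl, hyz⟩) hy
    simp only [sum_indicator_prod_succ μ]
    refine (pow_mul_sum_le_of_le_apply hp1 hk (hμ 0) (hμ1 0) (hp 0) (fun t => hnonneg _)
      (hmono hA) (fun t => hnonneg _) (hmono hB)).trans ?_
    refine Finset.sum_le_sum fun t _ => mul_le_mul_of_nonneg_left ?_ (hμ 0 t)
    exact ih (fun i => hμ i.succ) (fun i => hμ1 i.succ) (fun i => hT i.succ)
      (fun i => hp i.succ) (hsection hA t) (hsection hB t)


/-- **Generalized Harris inequality for products of posets** (Lemma 3.1).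
For every `p > 0` there is `C = C(p) > 0` such that for any `n ≥ 1`, any finite
posets `P 0, …, P (n-1)` each with a greatest element, and any probability
measures `μ i` on `P i` giving probability at least `p` to the greatest element,
the product measure of the intersection of any two upsets `A`, `B` in the
product poset is at least `(μ(A)·μ(B))^C`. -/
theorem generalized_harris_product_posets (p : ℝ) (hp : 0 < p) :
    ∃ C : ℝ, 0 < C ∧
      ∀ (n : ℕ), 1 ≤ n →
      ∀ (P : Fin n → Type) [∀ i, Fintype (P i)] [∀ i, PartialOrder (P i)],
      ∀ (μ : ∀ i, P i → ℝ) (T : ∀ i, P i),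
        (∀ i (x : P i), 0 ≤ μ i x) →
        (∀ i, ∑ x : P i, μ i x = 1) →
        (∀ i (x : P i), x ≤ T i) →
        (∀ i, p ≤ μ i (T i)) →
        ∀ A B : Set (∀ i, P i), IsUpperSet A → IsUpperSet B →
          (∑ x : (∀ i, P i), (A ∩ B).indicator (fun y => ∏ i, μ i (y i)) x) ≥
            ((∑ x : (∀ i, P i), A.indicator (fun y => ∏ i, μ i (y i)) x) *
             (∑ x : (∀ i, P i), B.indicator (fun y => ∏ i, μ i (y i)) x)) ^ C := by
  have hq : 0 < min p (1 / 2) := lt_min hp (by norm_num)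
  obtain ⟨k, hk⟩ := exists_nat_ge (1 / min p (1 / 2))
  rw [div_le_iff₀ hq] at hk
  refine ⟨(k + 1 : ℕ), by positivity, ?_⟩
  intro n _ P _ _ μ T hμ hμ1 hT hpT A B hA hB
  rw [Real.rpow_natCast]
  exact pow_mul_le_sum_indicator_inter (p := min p (1 / 2)) ((min_le_right _ _).trans_lt (by norm_num))
    (by linarith) hμ hμ1 hT (fun i => (min_le_left _ _).trans (hpT i)) hA hB
end

section
/- Generalized Harris inequality with explicit exponent: Let 0 < p ≤ 1 and set C = ⌈2/p⌉. Let n ≥ 1, let P_1, …, P_n be finite posets each of which has a greatest element, for each i let μ_i be a probability measure on P_i assigning probability at least p to the greatest element of P_i, and let μ = μ_1 ⊗ ⋯ ⊗ μ_n be the product probability measure on the product poset P = P_1 × ⋯ × P_n (with the coordinatewise partial order). Then for any two upsets A and B in P one has μ(A ∩ B) ≥ (μ(A)·μ(B))^C. -/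
/-- The scalar inequality behind the one-coordinate step: `q` is the mass outside the greatest
element and `w` the average deficit there. -/
theorem one_sub_half_mul_pow_le {q w : ℝ} {C : ℕ} (hq : 0 ≤ q) (hq1 : q < 1)
    (hC : 2 ≤ (1 - q) * C) (hw : 0 ≤ w) (hw1 : w ≤ 1) :
    (1 - q * w / 2) ^ (2 * C) ≤ 1 - q + q * (1 - w) ^ C := by
  have hC2 : (2 : ℝ) ≤ C := by nlinarith [Nat.cast_nonneg (α := ℝ) C]
  obtain ⟨k, rfl⟩ : ∃ k, C = k + 1 := ⟨C - 1, by
    have : 2 ≤ C := by exact_mod_cast hC2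
    omega⟩
  let F : ℝ → ℝ := fun x => 1 - q + q * (1 - x) ^ (k + 1) - (1 - q * x / 2) ^ (2 * (k + 1))
  have hF (x : ℝ) : HasDerivAt F
      (q * (k + 1) * ((1 - q * x / 2) ^ (2 * k + 1) - (1 - x) ^ k)) x := by
    have h1 := (((hasDerivAt_id x).const_sub 1).pow (k + 1)).const_mul q
    have h2 := ((((hasDerivAt_id x).const_mul q).div_const 2).const_sub 1).pow (2 * (k + 1))
    refine ((h1.const_add (1 - q)).sub h2).congr_deriv ?_
    have e : 2 * (k + 1) - 1 = 2 * k + 1 := by omega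
    simp only [e, id, Nat.add_sub_cancel]
    push_cast
    ring
  have hmono : MonotoneOn F (Set.Icc 0 1) := by
    refine monotoneOn_of_deriv_nonneg (convex_Icc 0 1)
      (fun x _ => (hF x).continuousAt.continuousWithinAt)
      (fun x _ => (hF x).differentiableAt.differentiableWithinAt) fun x hx => ?_
    rw [interior_Icc] at hx
    obtain ⟨hx0, hx1⟩ := hx
    rw [(hF x).deriv]
    refine mul_nonneg (by positivity) (sub_nonneg.2 ?_)
    have hqx : q * x ≤ x := by nlinarith
    have hsq : (1 - x) * (1 + (1 - q) * x) ≤ (1 - q * x / 2) ^ 2 := by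
      nlinarith [sq_nonneg (q * x), mul_nonneg (sub_nonneg.2 hq1.le) (sq_nonneg x)]
    have hbern : 1 + x ≤ (1 + (1 - q) * x) ^ k := by
      have h := one_add_mul_le_pow (a := (1 - q) * x) (by nlinarith) k
      push_cast at hC
      nlinarith
    have hlin : 1 ≤ (1 + x) * (1 - q * x / 2) := by nlinarith
    calc (1 - x) ^ k ≤ (1 - x) ^ k * ((1 + x) * (1 - q * x / 2)) :=
          le_mul_of_one_le_right (pow_nonneg (by linarith) _) hlin
      _ ≤ (1 - x) ^ k * ((1 + (1 - q) * x) ^ k * (1 - q * x / 2)) :=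
          mul_le_mul_of_nonneg_left (mul_le_mul_of_nonneg_right hbern (by linarith))
            (pow_nonneg (by linarith) _)
      _ = ((1 - x) * (1 + (1 - q) * x)) ^ k * (1 - q * x / 2) := by rw [mul_pow]; ring
      _ ≤ ((1 - q * x / 2) ^ 2) ^ k * (1 - q * x / 2) :=
          mul_le_mul_of_nonneg_right
            (pow_le_pow_left₀ (mul_nonneg (by linarith) (by nlinarith)) hsq k) (by linarith)
      _ = (1 - q * x / 2) ^ (2 * k + 1) := by rw [pow_succ _ (2 * k), pow_mul]
  have h := hmono (Set.left_mem_Icc.2 zero_le_one) ⟨hw, hw1⟩ hw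
  simp only [F, mul_zero, sub_zero, zero_div, one_pow, mul_one] at h
  linarith

section OneCoordinate

variable {α : Type*} [Fintype α] {m : α → ℝ} {t : α} {C : ℕ} {a b : α → ℝ}

theorem mean_mul_mean_pow_le_of_top_eq_one (hm : ∀ x, 0 ≤ m x) (hsum : ∑ x, m x = 1)
    (hC : 2 ≤ m t * C) (ha : ∀ x, 0 ≤ a x) (hb : ∀ x, 0 ≤ b x)
    (ha1 : ∀ x, a x ≤ 1) (hb1 : ∀ x, b x ≤ 1) (hat : a t = 1) (hbt : b t = 1) :
    ((∑ x, m x * a x) * ∑ x, m x * b x) ^ C ≤ ∑ x, m x * (a x * b x) ^ C := by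
  classical
  set q := ∑ x ∈ Finset.univ.erase t, m x with hq
  set Z := ∑ x ∈ Finset.univ.erase t, m x * (a x * b x) with hZ
  have hsplit (f : α → ℝ) : ∑ x, f x = f t + ∑ x ∈ Finset.univ.erase t, f x :=
    (Finset.add_sum_erase _ _ (Finset.mem_univ t)).symm
  have hmq : m t = 1 - q := by
    have := hsplit m
    linarith
  have hq0 : 0 ≤ q := Finset.sum_nonneg fun x _ => hm x
  have hZ0 : 0 ≤ Z := Finset.sum_nonneg fun x _ => by
    have := hm x; have := ha x; have := hb x; positivity
  have hZq : Z ≤ q := Finset.sum_le_sum fun x _ =>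
    mul_le_of_le_one_right (hm x) (mul_le_one₀ (ha1 x) (hb x) (hb1 x))
  have hq1 : q < 1 := by
    rcases (hm t).eq_or_lt with h | h
    · rw [← h] at hC; norm_num at hC
    · linarith
  have hEa : 0 ≤ ∑ x, m x * a x := Finset.sum_nonneg fun x _ => mul_nonneg (hm x) (ha x)
  have hEb : 0 ≤ ∑ x, m x * b x := Finset.sum_nonneg fun x _ => mul_nonneg (hm x) (hb x)
  have hadd : (∑ x, m x * a x) + ∑ x, m x * b x ≤ 2 - q + Z := by
    have h : (∑ x, m x * a x) + ∑ x, m x * b x ≤ ∑ x, (m x + m x * (a x * b x)) := by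
      rw [← Finset.sum_add_distrib]
      refine Finset.sum_le_sum fun x _ => ?_
      nlinarith [mul_nonneg (hm x) (mul_nonneg (sub_nonneg.2 (ha1 x)) (sub_nonneg.2 (hb1 x)))]
    rw [Finset.sum_add_distrib, hsum, hsplit fun x => m x * (a x * b x), hat, hbt, hmq] at h
    linarith
  rw [hsplit fun x => m x * (a x * b x) ^ C, hat, hbt, hmq]
  -- `w` is the average of `1 - a * b` off the greatest element
  obtain ⟨w, hw0, hw1, hwZ, hjensen⟩ : ∃ w : ℝ, 0 ≤ w ∧ w ≤ 1 ∧ Z = q * (1 - w) ∧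
      q * (1 - w) ^ C ≤ ∑ x ∈ Finset.univ.erase t, m x * (a x * b x) ^ C := by
    rcases hq0.eq_or_lt with h0 | hpos
    · refine ⟨0, le_rfl, zero_le_one, by linarith, ?_⟩
      rw [← h0, zero_mul]
      exact Finset.sum_nonneg fun x _ =>
        mul_nonneg (hm x) (pow_nonneg (mul_nonneg (ha x) (hb x)) _)
    · refine ⟨1 - Z / q, sub_nonneg.2 (div_le_one_of_le₀ hZq hq0),
        sub_le_self _ (div_nonneg hZ0 hq0), by field_simp; ring, ?_⟩
      have h := Real.pow_arith_mean_le_arith_mean_pow (Finset.univ.erase t)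
        (fun x => m x / q) (fun x => a x * b x) (fun x _ => div_nonneg (hm x) hq0)
        (by rw [← Finset.sum_div, ← hq, div_self hpos.ne'])
        (fun x _ => mul_nonneg (ha x) (hb x)) C
      simp only [div_mul_eq_mul_div, ← Finset.sum_div] at h
      rw [← hZ, le_div_iff₀ hpos] at h
      rw [sub_sub_cancel]
      linarith
  have hprod : (∑ x, m x * a x) * ∑ x, m x * b x ≤ (1 - q * w / 2) ^ 2 := by
    have hs : ((∑ x, m x * a x) + ∑ x, m x * b x) / 2 ≤ 1 - q * w / 2 := by linarith
    have := pow_le_pow_left₀ (by positivity) hs 2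
    nlinarith [sq_nonneg ((∑ x, m x * a x) - ∑ x, m x * b x)]
  calc ((∑ x, m x * a x) * ∑ x, m x * b x) ^ C ≤ ((1 - q * w / 2) ^ 2) ^ C :=
        pow_le_pow_left₀ (mul_nonneg hEa hEb) hprod C
    _ = (1 - q * w / 2) ^ (2 * C) := (pow_mul _ _ _).symm
    _ ≤ 1 - q + q * (1 - w) ^ C :=
        one_sub_half_mul_pow_le hq0 hq1 (by rwa [← hmq]) hw0 hw1
    _ ≤ _ := by rw [mul_one, one_pow, mul_one]; linarith

theorem mean_mul_mean_pow_le (hm : ∀ x, 0 ≤ m x) (hsum : ∑ x, m x = 1)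
    (hC : 2 ≤ m t * C) (ha : ∀ x, 0 ≤ a x) (hb : ∀ x, 0 ≤ b x)
    (hat : ∀ x, a x ≤ a t) (hbt : ∀ x, b x ≤ b t) :
    ((∑ x, m x * a x) * ∑ x, m x * b x) ^ C ≤ ∑ x, m x * (a x * b x) ^ C := by
  have hC0 : C ≠ 0 := by rintro rfl; norm_num at hC
  have hnn : 0 ≤ ∑ x, m x * (a x * b x) ^ C := Finset.sum_nonneg fun x _ =>
    mul_nonneg (hm x) (pow_nonneg (mul_nonneg (ha x) (hb x)) _)
  rcases (ha t).eq_or_lt with ha0 | ha0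
  · have h (x) : a x = 0 := le_antisymm (ha0 ▸ hat x) (ha x)
    have h0 : ∑ x, m x * a x = 0 := by simp [h]
    rwa [h0, zero_mul, zero_pow hC0]
  rcases (hb t).eq_or_lt with hb0 | hb0
  · have h (x) : b x = 0 := le_antisymm (hb0 ▸ hbt x) (hb x)
    have h0 : ∑ x, m x * b x = 0 := by simp [h]
    rwa [h0, mul_zero, zero_pow hC0]
  have key := mean_mul_mean_pow_le_of_top_eq_one (a := fun x => a x / a t)
    (b := fun x => b x / b t) hm hsum hC (fun x => div_nonneg (ha x) ha0.le)
    (fun x => div_nonneg (hb x) hb0.le) (fun x => div_le_one_of_le₀ (hat x) ha0.le)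
    (fun x => div_le_one_of_le₀ (hbt x) hb0.le) (div_self ha0.ne') (div_self hb0.ne')
  simp only [div_mul_div_comm, div_pow] at key
  simp only [mul_div_assoc', ← Finset.sum_div] at key
  rw [div_mul_eq_mul_div, div_div, div_pow] at key
  exact (div_le_div_iff_of_pos_right (by positivity)).1 key

end OneCoordinate

section ProductMass

/-- The mass of `A` under the product of the weights `μ i`. -/
noncomputable def productMass {n : ℕ} {P : Fin n → Type*} [∀ i, Fintype (P i)]
    (μ : ∀ i, P i → ℝ) (A : Set (∀ i, P i)) : ℝ :=
  ∑ x : (∀ i, P i), A.indicator (fun y => ∏ i, μ i (y i)) x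

theorem productMass_nonneg {n : ℕ} {P : Fin n → Type*} [∀ i, Fintype (P i)]
    {μ : ∀ i, P i → ℝ} (hμ : ∀ i x, 0 ≤ μ i x) (A : Set (∀ i, P i)) : 0 ≤ productMass μ A :=
  Finset.sum_nonneg fun _ _ =>
    Set.indicator_nonneg (fun _ _ => Finset.prod_nonneg fun i _ => hμ i _) _

theorem productMass_mono {n : ℕ} {P : Fin n → Type*} [∀ i, Fintype (P i)]
    {μ : ∀ i, P i → ℝ} (hμ : ∀ i x, 0 ≤ μ i x) {A B : Set (∀ i, P i)} (h : A ⊆ B) :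
    productMass μ A ≤ productMass μ B :=
  Finset.sum_le_sum fun _ _ =>
    Set.indicator_le_indicator_of_subset h (fun _ => Finset.prod_nonneg fun i _ => hμ i _) _

theorem productMass_succ {n : ℕ} {P : Fin (n + 1) → Type*} [∀ i, Fintype (P i)]
    (μ : ∀ i, P i → ℝ) (A : Set (∀ i, P i)) :
    productMass μ A =
      ∑ x, μ 0 x * productMass (fun i => μ (Fin.succ i)) {y | Fin.cons x y ∈ A} := by
  classical
  unfold productMass
  rw [← (Fin.consEquiv P).sum_comp, Fintype.sum_prod_type]
  refine Finset.sum_congr rfl fun x _ => ?_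
  rw [Finset.mul_sum]
  refine Finset.sum_congr rfl fun y _ => ?_
  simp [Set.indicator_apply, Fin.consEquiv, Fin.prod_univ_succ]

theorem productMass_mul_pow_le_inter {C : ℕ} {n : ℕ} {P : Fin n → Type*} [∀ i, Fintype (P i)]
    [∀ i, PartialOrder (P i)] {μ : ∀ i, P i → ℝ} {T : ∀ i, P i} (hC0 : C ≠ 0)
    (hμ : ∀ i x, 0 ≤ μ i x) (hsum : ∀ i, ∑ x, μ i x = 1) (hT : ∀ i x, x ≤ T i)
    (hC : ∀ i, 2 ≤ μ i (T i) * C) {A B : Set (∀ i, P i)} (hA : IsUpperSet A)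
    (hB : IsUpperSet B) :
    (productMass μ A * productMass μ B) ^ C ≤ productMass μ (A ∩ B) := by
  classical
  induction n with
  | zero =>
    have hmass (D : Set (∀ i, P i)) :
        productMass μ D = D.indicator (fun _ => 1) default := by
      rw [productMass, Fintype.sum_unique]
      simp [Set.indicator_apply]
    rw [hmass, hmass, hmass]
    by_cases hxA : default ∈ A <;> by_cases hxB : default ∈ B <;> simp [hxA, hxB, hC0]
  | succ n ih =>
    have hslice {D : Set (∀ i, P i)} (hD : IsUpperSet D) (x : P 0) :
        IsUpperSet {y : ∀ i : Fin n, P i.succ | Fin.cons x y ∈ D} := fun y z hyz hy =>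
      hD (Fin.cons_le_cons.2 ⟨le_rfl, hyz⟩) hy
    have htop {D : Set (∀ i, P i)} (hD : IsUpperSet D) (x : P 0) :
        {y : ∀ i : Fin n, P i.succ | Fin.cons x y ∈ D} ⊆ {y | Fin.cons (T 0) y ∈ D} :=
      fun y hy => hD (Fin.cons_le_cons.2 ⟨hT 0 x, le_rfl⟩) hy
    rw [productMass_succ μ A, productMass_succ μ B, productMass_succ μ (A ∩ B)]
    refine (mean_mul_mean_pow_le (hμ 0) (hsum 0) (hC 0)
      (fun x => productMass_nonneg (fun i => hμ i.succ) _)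
      (fun x => productMass_nonneg (fun i => hμ i.succ) _)
      (fun x => productMass_mono (fun i => hμ i.succ) (htop hA x))
      (fun x => productMass_mono (fun i => hμ i.succ) (htop hB x))).trans ?_
    exact Finset.sum_le_sum fun x _ => mul_le_mul_of_nonneg_left
      (ih (fun i => hμ i.succ) (fun i => hsum i.succ) (fun i => hT i.succ)
        (fun i => hC i.succ) (hslice hA x) (hslice hB x)) (hμ 0 x)

end ProductMass


/-- **Generalized Harris inequality with explicit exponent** `C = ⌈2/p⌉`. -/
theorem generalized_harris_explicit_exponent (p : ℝ) (hp : 0 < p) (hp1 : p ≤ 1) :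
    ∀ (n : ℕ), 1 ≤ n →
    ∀ (P : Fin n → Type) [∀ i, Fintype (P i)] [∀ i, PartialOrder (P i)],
    ∀ (μ : ∀ i, P i → ℝ) (T : ∀ i, P i),
      (∀ i (x : P i), 0 ≤ μ i x) →
      (∀ i, ∑ x : P i, μ i x = 1) →
      (∀ i (x : P i), x ≤ T i) →
      (∀ i, p ≤ μ i (T i)) →
      ∀ A B : Set (∀ i, P i), IsUpperSet A → IsUpperSet B →
        (∑ x : (∀ i, P i), (A ∩ B).indicator (fun y => ∏ i, μ i (y i)) x) ≥
          ((∑ x : (∀ i, P i), A.indicator (fun y => ∏ i, μ i (y i)) x) *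
           (∑ x : (∀ i, P i), B.indicator (fun y => ∏ i, μ i (y i)) x)) ^ (⌈2 / p⌉₊) := by
  intro n _ P _ _ μ T hμ hsum hT hp_le A B hA hB
  refine productMass_mul_pow_le_inter (Nat.ceil_pos.2 (by positivity)).ne' hμ hsum hT
    (fun i => ?_) hA hB
  calc (2 : ℝ) = p * (2 / p) := by field_simp
    _ ≤ μ i (T i) * ⌈2 / p⌉₊ :=
      mul_le_mul (hp_le i) (Nat.le_ceil _) (by positivity) (hμ i _)
end

section
/- Square-root trick for posets (Corollary 3.3): Let P be a finite poset with a least element x_0, and let μ be a probability measure on P with μ(x_0) > 0. For every ε > 0 and every positive integer k there exists δ = δ(P, μ, k, ε) > 0 such that for every n ≥ 1, if A_1, …, A_k are upsets in P^n with μ^n(A_1 ∪ ⋯ ∪ A_k) ≥ 1 − δ, then μ^n(A_i) ≥ 1 − ε for some i. -/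
/-- The expectation of `f` under the `n`-fold product of the weights `μ`. -/
def prodExp {P : Type} [Fintype P] (μ : P → ℝ) {n : ℕ} (f : (Fin n → P) → ℝ) : ℝ :=
  ∑ x : Fin n → P, (∏ i, μ (x i)) * f x

lemma prodExp_succ {P : Type} [Fintype P] (μ : P → ℝ) {n : ℕ} (f : (Fin (n + 1) → P) → ℝ) :
    prodExp μ f = ∑ p, μ p * prodExp μ (fun y : Fin n → P => f (Fin.cons p y)) := by
  unfold prodExp
  rw [← (Fin.consEquiv (fun _ : Fin (n + 1) => P)).sum_comp, Fintype.sum_prod_type]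
  refine Finset.sum_congr rfl fun p _ => ?_
  rw [Finset.mul_sum]
  refine Finset.sum_congr rfl fun y _ => ?_
  simp [Fin.consEquiv, Fin.prod_univ_succ, mul_assoc]

lemma prodExp_mono {P : Type} [Fintype P] {μ : P → ℝ} (hμ0 : ∀ x, 0 ≤ μ x) {n : ℕ}
    {f g : (Fin n → P) → ℝ} (h : ∀ x, f x ≤ g x) : prodExp μ f ≤ prodExp μ g :=
  Finset.sum_le_sum fun x _ =>
    mul_le_mul_of_nonneg_left (h x) (Finset.prod_nonneg fun i _ => hμ0 (x i))

lemma prodExp_nonneg {P : Type} [Fintype P] {μ : P → ℝ} (hμ0 : ∀ x, 0 ≤ μ x) {n : ℕ}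
    {f : (Fin n → P) → ℝ} (h : ∀ x, 0 ≤ f x) : 0 ≤ prodExp μ f :=
  Finset.sum_nonneg fun x _ => mul_nonneg (Finset.prod_nonneg fun i _ => hμ0 (x i)) (h x)

lemma prodExp_one {P : Type} [Fintype P] {μ : P → ℝ} (hμ1 : ∑ x, μ x = 1) (n : ℕ) :
    prodExp μ (fun _ : Fin n → P => (1 : ℝ)) = 1 := by
  induction n with
  | zero => simp [prodExp]
  | succ n ih => rw [prodExp_succ]; simp [ih, hμ1]

/-- Second-order Bernoulli inequality. -/
lemma one_add_mul_add_sq_le_pow {t : ℝ} (ht : 0 ≤ t) (N : ℕ) :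
    1 + N * t + N * (N - 1) / 2 * t ^ 2 ≤ (1 + t) ^ N := by
  induction N with
  | zero => simp
  | succ N ih =>
    have h1 : (1 + N * t + N * (N - 1) / 2 * t ^ 2) * (1 + t) ≤ (1 + t) ^ N * (1 + t) :=
      mul_le_mul_of_nonneg_right ih (by linarith)
    have h2 : (0 : ℝ) ≤ N * (N - 1) := by
      rcases N with _ | N
      · simp
      · push_cast; nlinarith [(Nat.cast_nonneg N : (0 : ℝ) ≤ N)]
    have h3 : 0 ≤ (N * (N - 1) : ℝ) * t ^ 3 := by positivity
    rw [pow_succ (1 + t)]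
    push_cast
    linarith

/-- One-coordinate inequality for functions with values in `[0, 1]` equal to `1` at `x0`. -/
lemma pow_mul_pow_le_sum_of_eq_one {P : Type} [Fintype P] {x0 : P} {μ : P → ℝ}
    (hμ0 : ∀ x, 0 ≤ μ x) (hμ1 : ∑ x, μ x = 1) {N : ℕ} (hN : 2 ≤ μ x0 * (N - 1))
    {F G : P → ℝ} (hF : ∀ x, 0 ≤ F x) (hG : ∀ x, 0 ≤ G x) (hF1 : ∀ x, F x ≤ 1)
    (hG1 : ∀ x, G x ≤ 1) (hF0 : F x0 = 1) (hG0 : G x0 = 1) :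
    (∑ x, μ x * F x) ^ N * (∑ x, μ x * G x) ^ N ≤ ∑ x, μ x * (F x ^ N * G x ^ N) := by
  classical
  have hN0 : N ≠ 0 := by
    rintro rfl
    have := hμ0 x0
    norm_num at hN
    linarith
  set a := ∑ x, μ x * F x with ha
  set b := ∑ x, μ x * G x with hb
  have ha0 : 0 ≤ a := Finset.sum_nonneg fun x _ => mul_nonneg (hμ0 x) (hF x)
  have hb0 : 0 ≤ b := Finset.sum_nonneg fun x _ => mul_nonneg (hμ0 x) (hG x)
  have ha1 : a ≤ 1 := hμ1 ▸ Finset.sum_le_sum fun x _ => mul_le_of_le_one_right (hμ0 x) (hF1 x)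
  have hb1 : b ≤ 1 := hμ1 ▸ Finset.sum_le_sum fun x _ => mul_le_of_le_one_right (hμ0 x) (hG1 x)
  have hR : 0 ≤ ∑ x, μ x * (F x ^ N * G x ^ N) := Finset.sum_nonneg fun x _ =>
    mul_nonneg (hμ0 x) (mul_nonneg (pow_nonneg (hF x) _) (pow_nonneg (hG x) _))
  rw [← mul_pow]
  rcases (mul_nonneg ha0 hb0).eq_or_lt with h0 | hX
  · rw [← h0, zero_pow hN0]
    exact hR
  set X := a * b with hXdef
  have hX1 : X ≤ 1 := mul_le_one₀ ha1 hb0 hb1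
  have hmean : a + b - 1 ≤ ∑ x, μ x * (F x * G x) := by
    rw [ha, hb, ← hμ1, ← Finset.sum_add_distrib, ← Finset.sum_sub_distrib]
    refine Finset.sum_le_sum fun x _ => ?_
    nlinarith [mul_nonneg (hμ0 x) (mul_nonneg (sub_nonneg.2 (hF1 x)) (sub_nonneg.2 (hG1 x)))]
  set t := 1 / X - 1 with ht
  have ht0 : 0 ≤ t := sub_nonneg.2 ((one_le_div hX).2 hX1)
  have hpt : ∀ x, μ x * (1 + N * (F x * G x / X - 1)) +
      (if x = x0 then μ x0 * (N * (N - 1) / 2 * t ^ 2) else 0)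
        ≤ μ x * (F x ^ N * G x ^ N / X ^ N) := by
    intro x
    split_ifs with h
    · subst h
      rw [hF0, hG0, ← mul_add]
      refine mul_le_mul_of_nonneg_left ?_ (hμ0 _)
      have := one_add_mul_add_sq_le_pow ht0 N
      have e : 1 + t = 1 / X := by rw [ht]; ring
      rw [e, one_div_pow] at this
      simpa only [one_pow, one_mul] using this
    · rw [add_zero, ← mul_pow, ← div_pow]
      refine mul_le_mul_of_nonneg_left ?_ (hμ0 _)
      have hW : 0 ≤ F x * G x / X := div_nonneg (mul_nonneg (hF x) (hG x)) hX.le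
      have := one_add_mul_le_pow (a := F x * G x / X - 1) (by linarith) N
      rwa [add_sub_cancel] at this
  have hsum := Finset.sum_le_sum fun x (_ : x ∈ Finset.univ) => hpt x
  have hL : ∑ x, (μ x * (1 + N * (F x * G x / X - 1)) +
      (if x = x0 then μ x0 * (N * (N - 1) / 2 * t ^ 2) else 0)) =
      1 + N * ((∑ x, μ x * (F x * G x)) / X - 1) + μ x0 * (N * (N - 1) / 2 * t ^ 2) := by
    rw [Finset.sum_add_distrib, Finset.sum_ite_eq' Finset.univ x0]
    simp only [Finset.mem_univ, if_true]
    congr 1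
    have : ∀ x, μ x * (1 + N * (F x * G x / X - 1)) =
        (1 - N) * μ x + N / X * (μ x * (F x * G x)) := fun x => by ring
    simp only [this]
    rw [Finset.sum_add_distrib, ← Finset.mul_sum, ← Finset.mul_sum, hμ1]
    ring
  have hRR : ∑ x, μ x * (F x ^ N * G x ^ N / X ^ N) =
      (∑ x, μ x * (F x ^ N * G x ^ N)) / X ^ N := by
    rw [Finset.sum_div]
    exact Finset.sum_congr rfl fun x _ => by ring
  rw [hL, hRR] at hsum
  have key : 1 ≤ (∑ x, μ x * (F x ^ N * G x ^ N)) / X ^ N := by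
    refine le_trans ?_ hsum
    have hN' : (0 : ℝ) ≤ N := Nat.cast_nonneg N
    have h1 : (a + b - 1) / X ≤ (∑ x, μ x * (F x * G x)) / X := by gcongr
    have h2 : t ^ 2 ≤ μ x0 * (N - 1) / 2 * t ^ 2 := by
      nlinarith [sq_nonneg t]
    have h3 : 0 ≤ (a + b - 1) / X - 1 + t ^ 2 := by
      have h4 : (a + b - 1) / X - 1 + t ^ 2 = ((a + b - 1 - X) * X + (1 - X) ^ 2) / X ^ 2 := by
        rw [ht]; field_simp
      rw [h4]
      refine div_nonneg ?_ (sq_nonneg _)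
      have h5 : 1 - a ≤ 1 - X := by nlinarith
      have h6 : 1 - b ≤ 1 - X := by nlinarith
      have h7 : (1 - a) * (1 - b) ≤ (1 - X) * (1 - X) :=
        mul_le_mul h5 h6 (by linarith) (by linarith)
      have h8 : 0 ≤ (1 - a) * (1 - b) := mul_nonneg (by linarith) (by linarith)
      have h9 : a + b - 1 - X = -((1 - a) * (1 - b)) := by rw [hXdef]; ring
      rw [h9]
      nlinarith
    have h10 : 0 ≤ (∑ x, μ x * (F x * G x)) / X - 1 + μ x0 * (N - 1) / 2 * t ^ 2 := by linarith
    nlinarith [mul_nonneg hN' h10]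
  rwa [one_le_div (pow_pos hX N)] at key

/-- One-coordinate inequality for nonnegative functions maximal at `x0`. -/
lemma pow_mul_pow_le_sum {P : Type} [Fintype P] {x0 : P} {μ : P → ℝ}
    (hμ0 : ∀ x, 0 ≤ μ x) (hμ1 : ∑ x, μ x = 1) {N : ℕ} (hN : 2 ≤ μ x0 * (N - 1))
    {F G : P → ℝ} (hF : ∀ x, 0 ≤ F x) (hG : ∀ x, 0 ≤ G x) (hF1 : ∀ x, F x ≤ F x0)
    (hG1 : ∀ x, G x ≤ G x0) :
    (∑ x, μ x * F x) ^ N * (∑ x, μ x * G x) ^ N ≤ ∑ x, μ x * (F x ^ N * G x ^ N) := by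
  have hN0 : N ≠ 0 := by
    rintro rfl
    have := hμ0 x0
    norm_num at hN
    linarith
  rcases (hF x0).eq_or_lt with h | hFp
  · have : ∀ x, F x = 0 := fun x => le_antisymm (h ▸ hF1 x) (hF x)
    simp [this, hN0]
  rcases (hG x0).eq_or_lt with h | hGp
  · have : ∀ x, G x = 0 := fun x => le_antisymm (h ▸ hG1 x) (hG x)
    simp [this, hN0]
  have := pow_mul_pow_le_sum_of_eq_one hμ0 hμ1 hN (F := fun x => F x / F x0)
    (G := fun x => G x / G x0) (fun x => div_nonneg (hF x) hFp.le)
    (fun x => div_nonneg (hG x) hGp.le) (fun x => (div_le_one hFp).2 (hF1 x))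
    (fun x => (div_le_one hGp).2 (hG1 x)) (div_self hFp.ne') (div_self hGp.ne')
  have e : ∑ x, μ x * ((F x / F x0) ^ N * (G x / G x0) ^ N) =
      (∑ x, μ x * (F x ^ N * G x ^ N)) / (F x0 ^ N * G x0 ^ N) := by
    rw [Finset.sum_div]
    exact Finset.sum_congr rfl fun x _ => by rw [div_pow, div_pow]; ring
  have e' : ∀ (H : P → ℝ) (c : ℝ), ∑ x, μ x * (H x / c) = (∑ x, μ x * H x) / c := fun H c => by
    rw [Finset.sum_div]
    exact Finset.sum_congr rfl fun x _ => (mul_div_assoc _ _ _).symm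
  rw [e, e', e'] at this
  rw [div_pow, div_pow, div_mul_div_comm] at this
  exact (div_le_div_iff_of_pos_right (by positivity)).1 this

/-- Correlation inequality for antitone functions on a power of a poset with least element. -/
lemma prodExp_pow_mul_pow_le {P : Type} [Fintype P] [PartialOrder P] {x0 : P}
    (hx0 : ∀ x : P, x0 ≤ x) {μ : P → ℝ} (hμ0 : ∀ x, 0 ≤ μ x) (hμ1 : ∑ x, μ x = 1) {N : ℕ}
    (hN : 2 ≤ μ x0 * (N - 1)) {n : ℕ} {f g : (Fin n → P) → ℝ} (hf : ∀ x, 0 ≤ f x)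
    (hg : ∀ x, 0 ≤ g x) (hfa : Antitone f) (hga : Antitone g) :
    prodExp μ f ^ N * prodExp μ g ^ N ≤ prodExp μ (fun x => f x ^ N * g x ^ N) := by
  induction n with
  | zero => simp [prodExp]
  | succ n ih =>
    have hcons : ∀ p, Monotone fun y : Fin n → P => (Fin.cons p y : Fin (n + 1) → P) :=
      fun p y z h => Fin.cons_le_cons.2 ⟨le_rfl, h⟩
    have hmax : ∀ {h : (Fin (n + 1) → P) → ℝ}, Antitone h → ∀ p,
        prodExp μ (fun y : Fin n → P => h (Fin.cons p y)) ≤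
          prodExp μ (fun y : Fin n → P => h (Fin.cons x0 y)) := fun ha p =>
      prodExp_mono hμ0 fun y => ha (Fin.cons_le_cons.2 ⟨hx0 p, le_rfl⟩)
    rw [prodExp_succ, prodExp_succ, prodExp_succ μ (fun x => f x ^ N * g x ^ N)]
    refine (pow_mul_pow_le_sum hμ0 hμ1 hN (fun p => prodExp_nonneg hμ0 fun y => hf _)
      (fun p => prodExp_nonneg hμ0 fun y => hg _) (hmax hfa) (hmax hga)).trans ?_
    exact Finset.sum_le_sum fun p _ => mul_le_mul_of_nonneg_left
      (ih (fun y => hf _) (fun y => hg _) (hfa.comp_monotone (hcons p))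
        (hga.comp_monotone (hcons p))) (hμ0 p)

lemma IsLowerSet.antitone_indicator_one {α : Type*} [Preorder α] {D : Set α}
    (hD : IsLowerSet D) : Antitone (D.indicator (fun _ => (1 : ℝ))) := by
  intro x y hxy
  by_cases hy : y ∈ D
  · simp [hy, hD hxy hy]
  · rw [Set.indicator_of_notMem hy]
    exact Set.indicator_nonneg (fun _ _ => zero_le_one) x

/-- Lower sets of measure bounded below have an intersection of measure bounded below. -/
lemma exists_le_prodExp_iInter {P : Type} [Fintype P] [PartialOrder P] {x0 : P}
    (hx0 : ∀ x : P, x0 ≤ x) {μ : P → ℝ} (hμ0 : ∀ x, 0 ≤ μ x) (hμ1 : ∑ x, μ x = 1)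
    (hpos : 0 < μ x0) {ε : ℝ} (hε : 0 < ε) (k : ℕ) :
    ∃ δ : ℝ, 0 < δ ∧ ∀ (n : ℕ) (D : Fin k → Set (Fin n → P)), (∀ j, IsLowerSet (D j)) →
      (∀ j, ε ≤ prodExp μ ((D j).indicator fun _ => 1)) →
      δ ≤ prodExp μ ((⋂ j, D j).indicator fun _ => 1) := by
  obtain ⟨N, hN⟩ := exists_nat_ge (2 / μ x0 + 1)
  have hN2 : 2 ≤ μ x0 * (N - 1) := by
    have : 2 / μ x0 ≤ N - 1 := by linarith
    rwa [div_le_iff₀' hpos] at this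
  have hN0 : N ≠ 0 := by
    rintro rfl
    norm_num at hN2
    linarith
  induction k with
  | zero =>
    refine ⟨1, one_pos, fun n D _ _ => ?_⟩
    simp [prodExp_one hμ1]
  | succ k ih =>
    obtain ⟨δ, hδ, h⟩ := ih
    refine ⟨ε ^ N * δ ^ N, by positivity, fun n D hD hm => ?_⟩
    have h1 := h n (fun j => D j.succ) (fun j => hD _) (fun j => hm _)
    have h2 := prodExp_pow_mul_pow_le hx0 hμ0 hμ1 hN2
      (f := (D 0).indicator fun _ => (1 : ℝ)) (g := (⋂ j : Fin k, D j.succ).indicator fun _ => 1)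
      (Set.indicator_nonneg fun _ _ => zero_le_one) (Set.indicator_nonneg fun _ _ => zero_le_one)
      (hD 0).antitone_indicator_one
      (isLowerSet_iInter fun j => hD _).antitone_indicator_one
    have e : (fun x => (D 0).indicator (fun _ => (1 : ℝ)) x ^ N *
        (⋂ j : Fin k, D j.succ).indicator (fun _ => (1 : ℝ)) x ^ N) =
        (⋂ j, D j).indicator fun _ => 1 := by
      classical
      funext x
      simp only [Set.indicator_apply, Set.mem_iInter, Fin.forall_fin_succ (P := fun j => x ∈ D j)]
      split_ifs <;> simp_all
    rw [e] at h2
    refine le_trans ?_ h2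
    have h3 := hm 0
    have h4 := pow_nonneg (hε.le.trans h3) N
    gcongr

lemma sum_indicator_eq_prodExp {P : Type} [Fintype P] (μ : P → ℝ) {n : ℕ}
    (A : Set (Fin n → P)) :
    ∑ x : Fin n → P, A.indicator (fun y => ∏ i, μ (y i)) x =
      prodExp μ (A.indicator fun _ => 1) := by
  classical
  simp [prodExp, Set.indicator_apply]

lemma prodExp_indicator_compl {P : Type} [Fintype P] {μ : P → ℝ} (hμ1 : ∑ x, μ x = 1) {n : ℕ}
    (A : Set (Fin n → P)) :
    prodExp μ (Aᶜ.indicator fun _ => 1) = 1 - prodExp μ (A.indicator fun _ => 1) := by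
  rw [eq_sub_iff_add_eq]
  refine Eq.trans ?_ (prodExp_one hμ1 n)
  unfold prodExp
  rw [← Finset.sum_add_distrib]
  refine Finset.sum_congr rfl fun x _ => ?_
  by_cases hx : x ∈ A <;> simp [hx]


/-- **Square-root trick for posets** (Corollary 3.3).
For a finite poset `P` with least element `x₀` of positive probability, any
`ε > 0` and positive integer `k`, there is `δ > 0` such that for any `n ≥ 1`
and upsets `A₁, …, A_k` of `P^n` whose union has measure at least `1 - δ`,
some `A_j` has measure at least `1 - ε`. -/
theorem square_root_trick_posets (P : Type) [Fintype P] [PartialOrder P]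
    (x0 : P) (hx0 : ∀ x : P, x0 ≤ x)
    (μ : P → ℝ) (hμ0 : ∀ x, 0 ≤ μ x) (hμ1 : ∑ x : P, μ x = 1) (hpos : 0 < μ x0)
    (ε : ℝ) (hε : 0 < ε) (k : ℕ) (hk : 0 < k) :
    ∃ δ : ℝ, 0 < δ ∧
      ∀ (n : ℕ), 1 ≤ n → ∀ A : Fin k → Set (Fin n → P),
        (∀ j, IsUpperSet (A j)) →
        (∑ x : Fin n → P, (⋃ j, A j).indicator (fun y => ∏ i, μ (y i)) x) ≥ 1 - δ →
        ∃ j, (∑ x : Fin n → P, (A j).indicator (fun y => ∏ i, μ (y i)) x) ≥ 1 - ε := by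
  obtain ⟨δ, hδ, h⟩ := exists_le_prodExp_iInter hx0 hμ0 hμ1 hpos hε k
  refine ⟨δ / 2, by positivity, fun n _ A hA hU => ?_⟩
  by_contra! hcon
  simp only [sum_indicator_eq_prodExp] at hU hcon
  have hI := h n (fun j => (A j)ᶜ) (fun j => (hA j).compl) fun j => by
    rw [prodExp_indicator_compl hμ1]
    linarith [hcon j]
  rw [← Set.compl_iUnion, prodExp_indicator_compl hμ1] at hI
  linarith
end

section
/- Square-crossing lemma for critical bond percolation on ℤ² (Lemma 5.1): There is a constant c_1 > 0 such that for every integer n ≥ 1 and all integers a, b, the square S = [a, a+n] × [b, b+n] satisfies Pr(H(S)) = Pr(V(S)) ≥ c_1. -/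
open MeasureTheory

/-- A bond of the grid `ℤ²`: `(v, true)` is the bond joining `v` to `v + (1,0)`,
and `(v, false)` is the bond joining `v` to `v + (0,1)`. -/
abbrev GridBond : Type := (ℤ × ℤ) × Bool

/-- A percolation configuration: each bond is open (`true`) or closed (`false`). -/
abbrev PercCfg : Type := GridBond → Bool

/-- The vertices `u` and `v` are adjacent in `ℤ²` and the bond joining them is
open in the configuration `ω`. -/
def BondOpen (ω : PercCfg) (u v : ℤ × ℤ) : Prop :=
  (v = (u.1 + 1, u.2) ∧ ω (u, true) = true) ∨
  (u = (v.1 + 1, v.2) ∧ ω (v, true) = true) ∨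
  (v = (u.1, u.2 + 1) ∧ ω (u, false) = true) ∨
  (u = (v.1, v.2 + 1) ∧ ω (v, false) = true)

/-- `v` lies in the rectangle `[a,b] × [c,d]` of `ℤ²`. -/
def InRect (a b c d : ℤ) (v : ℤ × ℤ) : Prop :=
  a ≤ v.1 ∧ v.1 ≤ b ∧ c ≤ v.2 ∧ v.2 ≤ d

/-- `Pth 0, Pth 1, …, Pth k` is an open lattice path in the rectangle
`[a,b] × [c,d]`. -/
def OpenPathIn (ω : PercCfg) (a b c d : ℤ) (k : ℕ) (Pth : ℕ → ℤ × ℤ) : Prop :=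
  (∀ i ≤ k, InRect a b c d (Pth i)) ∧ ∀ i < k, BondOpen ω (Pth i) (Pth (i + 1))

/-- The event that `[a,b] × [c,d]` has an open horizontal crossing. -/
def HCross (a b c d : ℤ) : Set PercCfg :=
  {ω | ∃ k Pth, OpenPathIn ω a b c d k Pth ∧ (Pth 0).1 = a ∧ (Pth k).1 = b}

/-- The event that `[a,b] × [c,d]` has an open vertical crossing. -/
def VCross (a b c d : ℤ) : Set PercCfg :=
  {ω | ∃ k Pth, OpenPathIn ω a b c d k Pth ∧ (Pth 0).2 = c ∧ (Pth k).2 = d}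

/-- `Pr` is the i.i.d. Bernoulli(1/2) bond percolation measure on `ℤ²`: a
probability measure under which the states of the bonds are independent, each
open with probability `1/2`. -/
def IsBondPerc (Pr : Measure PercCfg) : Prop :=
  IsProbabilityMeasure Pr ∧
    ∀ (s : Finset GridBond) (f : GridBond → Bool),
      Pr {ω | ∀ e ∈ s, ω e = f e} = (1 / 2 : ENNReal) ^ s.card

/-! ### Invariance of critical percolation under relabelling and flipping bonds -/

/-- The cylinder events determine a bond percolation measure. -/
theorem IsBondPerc.ext {μ ν : Measure PercCfg} (hμ : IsBondPerc μ) (hν : IsBondPerc ν) :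
    μ = ν := by
  have := hμ.1
  have := hν.1
  let C : Set (Set PercCfg) :=
    {A | ∃ (s : Finset GridBond) (f : GridBond → Bool), A = {ω | ∀ e ∈ s, ω e = f e}}
  refine ext_of_generate_finite C ?_ ?_ ?_ (by simp)
  · refine le_antisymm ?_ ?_
    · refine iSup_le fun e => Measurable.comap_le ?_
      refine @measurable_to_bool PercCfg (MeasurableSpace.generateFrom C) _ ?_
      exact MeasurableSpace.measurableSet_generateFrom ⟨{e}, fun _ => true, by ext; simp⟩
    · refine MeasurableSpace.generateFrom_le ?_
      rintro _ ⟨s, f, rfl⟩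
      have : {ω : PercCfg | ∀ e ∈ s, ω e = f e} = ⋂ e ∈ s, (fun ω => ω e) ⁻¹' {f e} := by
        ext; simp
      rw [this]
      exact s.measurableSet_biInter fun e _ => measurable_pi_apply e (measurableSet_singleton _)
  · classical
    rintro _ ⟨s, f, rfl⟩ _ ⟨t, g, rfl⟩ ⟨ω₀, h₁, h₂⟩
    refine ⟨s ∪ t, ω₀, ?_⟩
    ext ω
    simp only [Set.mem_inter_iff, Set.mem_ofPred_eq, Finset.mem_union] at h₁ h₂ ⊢
    grind
  · rintro _ ⟨s, f, rfl⟩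
    rw [hμ.2, hν.2]

/-- Relabelling the bonds by `σ` and the states by `g`. -/
def relabel (σ : GridBond ≃ GridBond) (g : Bool ≃ Bool) : PercCfg ≃ᵐ PercCfg where
  toFun ω e := g (ω (σ e))
  invFun ω e := g.symm (ω (σ.symm e))
  left_inv ω := by simp
  right_inv ω := by simp
  measurable_toFun := measurable_pi_lambda _ fun e =>
    (measurable_of_countable g).comp (measurable_pi_apply (σ e))
  measurable_invFun := measurable_pi_lambda _ fun e =>
    (measurable_of_countable g.symm).comp (measurable_pi_apply (σ.symm e))

theorem relabel_apply (σ : GridBond ≃ GridBond) (g : Bool ≃ Bool) (ω : PercCfg) (e : GridBond) :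
    relabel σ g ω e = g (ω (σ e)) := rfl

theorem IsBondPerc.measure_preimage_relabel {Pr : Measure PercCfg} (h : IsBondPerc Pr)
    (σ : GridBond ≃ GridBond) (g : Bool ≃ Bool) (A : Set PercCfg) :
    Pr (relabel σ g ⁻¹' A) = Pr A := by
  have := h.1
  have hmap : IsBondPerc (Pr.map (relabel σ g)) := by
    refine ⟨Measure.isProbabilityMeasure_map (relabel σ g).measurable.aemeasurable, fun s f => ?_⟩
    have hpre : relabel σ g ⁻¹' {ω | ∀ e ∈ s, ω e = f e} =
        {ω | ∀ e ∈ s.map σ.toEmbedding, ω e = g.symm (f (σ.symm e))} := by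
      ext ω
      simp only [Set.mem_preimage, Set.mem_ofPred_eq, Finset.forall_mem_map, relabel_apply,
        Equiv.coe_toEmbedding, Equiv.symm_apply_apply, Equiv.eq_symm_apply]
    rw [MeasurableEquiv.map_apply, hpre, h.2, Finset.card_map]
  rw [← MeasurableEquiv.map_apply, hmap.ext h]

/-! ### Reflection -/

/-- The reflection of bonds induced by exchanging the two coordinates around `(a, b)`. -/
def reflectBond (a b : ℤ) : GridBond ≃ GridBond where
  toFun e := ((a + (e.1.2 - b), b + (e.1.1 - a)), !e.2)
  invFun e := ((a + (e.1.2 - b), b + (e.1.1 - a)), !e.2)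
  left_inv e := by ext <;> simp
  right_inv e := by ext <;> simp

/-- Reflecting a path: vertical crossings are horizontal crossings of the reflected
configuration. -/
theorem preimage_relabel_reflectBond_hCross (a b n : ℤ) :
    relabel (reflectBond a b) (Equiv.refl _) ⁻¹' HCross a (a + n) b (b + n) =
      VCross a (a + n) b (b + n) := by
  ext ω
  have key : ∀ u v : ℤ × ℤ, BondOpen (relabel (reflectBond a b) (Equiv.refl _) ω) u v ↔
      BondOpen ω (a + (u.2 - b), b + (u.1 - a)) (a + (v.2 - b), b + (v.1 - a)) := by
    rintro ⟨u₁, u₂⟩ ⟨v₁, v₂⟩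
    simp only [BondOpen, relabel_apply, reflectBond, Equiv.coe_fn_mk, Equiv.refl_apply,
      Prod.mk.injEq, Bool.not_true, Bool.not_false]
    grind
  constructor
  · rintro ⟨k, p, ⟨hr, ho⟩, h0, hk⟩
    refine ⟨k, fun i => (a + ((p i).2 - b), b + ((p i).1 - a)), ⟨fun i hi => ?_, fun i hi => ?_⟩,
      ?_, ?_⟩
    · have := hr i hi
      simp only [InRect] at this ⊢
      omega
    · exact (key _ _).1 (ho i hi)
    · simp only; omega
    · simp only; omega
  · rintro ⟨k, p, ⟨hr, ho⟩, h0, hk⟩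
    refine ⟨k, fun i => (a + ((p i).2 - b), b + ((p i).1 - a)), ⟨fun i hi => ?_, fun i hi => ?_⟩,
      ?_, ?_⟩
    · have := hr i hi
      simp only [InRect] at this ⊢
      omega
    · rw [key]
      simpa using ho i hi
    · simp only; omega
    · simp only; omega

/-! ### Planar duality -/

/-- The bond of `ℤ²` crossed by a dual bond, where the dual lattice is identified with `ℤ²` by
shifting it by `(-1/2, 1/2)`. -/
def dualBond : GridBond ≃ GridBond where
  toFun e := if e.2 then ((e.1.1 + 1, e.1.2 - 1), false) else (e.1, true)
  invFun e := if e.2 then (e.1, false) else ((e.1.1 - 1, e.1.2 + 1), true)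
  left_inv := by rintro ⟨⟨x, y⟩, _ | _⟩ <;> simp
  right_inv := by rintro ⟨⟨x, y⟩, _ | _⟩ <;> simp

/-- The vertex `v` is joined to `A` by an open path in `[a,b] × [c,d]`. -/
def OpenReach (ω : PercCfg) (a b c d : ℤ) (A : Set (ℤ × ℤ)) (v : ℤ × ℤ) : Prop :=
  ∃ k p, OpenPathIn ω a b c d k p ∧ p 0 ∈ A ∧ p k = v

theorem OpenReach.of_mem {ω : PercCfg} {a b c d : ℤ} {A : Set (ℤ × ℤ)} {v : ℤ × ℤ}
    (hv : v ∈ A) (hr : InRect a b c d v) : OpenReach ω a b c d A v :=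
  ⟨0, fun _ => v, ⟨fun _ _ => hr, by simp⟩, hv, rfl⟩

theorem OpenReach.step {ω : PercCfg} {a b c d : ℤ} {A : Set (ℤ × ℤ)} {v w : ℤ × ℤ}
    (h : OpenReach ω a b c d A v) (hb : BondOpen ω v w) (hw : InRect a b c d w) :
    OpenReach ω a b c d A w := by
  obtain ⟨k, p, ⟨hr, ho⟩, h0, rfl⟩ := h
  refine ⟨k + 1, fun i => if i ≤ k then p i else w, ⟨fun i _ => ?_, fun i hi => ?_⟩, by simpa,
    by simp⟩
  · dsimp only
    split_ifs with h
    exacts [hr i h, hw]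
  · rcases Nat.lt_succ_iff_lt_or_eq.1 hi with h | rfl
    · simpa [h.le, Nat.succ_le_of_lt h] using ho i h
    · simpa using hb

theorem BondOpen.symm {ω : PercCfg} {u v : ℤ × ℤ} (h : BondOpen ω u v) : BondOpen ω v u := by
  unfold BondOpen at *
  tauto

theorem openReach_congr {ω : PercCfg} {a b c d : ℤ} {A : Set (ℤ × ℤ)} {v w : ℤ × ℤ}
    (hb : BondOpen ω v w) (hv : InRect a b c d v) (hw : InRect a b c d w) :
    OpenReach ω a b c d A v ↔ OpenReach ω a b c d A w :=
  ⟨fun h => h.step hb hw, fun h => h.step hb.symm hv⟩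

/-- Summation by parts when `f` vanishes at the ends and `g` only jumps where `f` vanishes. -/
theorem sum_range_sub_mul_eq_zero {n : ℕ} {f g : ℕ → ℤ} (h0 : f 0 = 0) (hn : f n = 0)
    (h : ∀ i, i + 1 < n → f (i + 1) * (g (i + 1) - g i) = 0) :
    ∑ i ∈ Finset.range n, (f (i + 1) - f i) * g i = 0 := by
  have key : ∀ k < n, ∑ i ∈ Finset.range (k + 1), (f (i + 1) - f i) * g i = f (k + 1) * g k := by
    intro k
    induction k with
    | zero => simp [h0]
    | succ k ih =>
      intro hk
      rw [Finset.sum_range_succ, ih (by omega)]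
      linear_combination -h k hk
  cases n with
  | zero => simp
  | succ k => rw [key k k.lt_succ_self, hn, zero_mul]

/-- Discrete planar duality: two functions on a rectangle, one with different constant values on
the left and right sides and the other on the bottom and top sides, must jump across a common
bond. -/
theorem false_of_jumps_disjoint {n m : ℕ} {χ κ : ℕ → ℕ → ℤ}
    (hleft : ∀ j ≤ m, χ 0 j = 1) (hright : ∀ j ≤ m, χ n j = 0)
    (hbot : ∀ i < n, κ i 0 = 1) (htop : ∀ i < n, κ i m = 0)
    (hH : ∀ i < n, ∀ j < m, (χ (i + 1) j - χ i j) * (κ i (j + 1) - κ i j) = 0)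
    (hV : ∀ i, i + 1 < n → ∀ j < m,
      (χ (i + 1) (j + 1) - χ (i + 1) j) * (κ (i + 1) (j + 1) - κ i (j + 1)) = 0) : False := by
  have key : ∀ j ≤ m, ∑ i ∈ Finset.range n, (χ (i + 1) j - χ i j) * κ i j = -1 := by
    intro j
    induction j with
    | zero =>
      intro _
      rw [Finset.sum_congr rfl fun i hi => by rw [hbot i (Finset.mem_range.1 hi), mul_one],
        Finset.sum_range_sub (fun i => χ i 0), hleft 0 m.zero_le, hright 0 m.zero_le]
      norm_num
    | succ j ih =>
      intro hj
      have hparts := sum_range_sub_mul_eq_zero (n := n) (f := fun i => χ i (j + 1) - χ i j)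
        (g := fun i => κ i (j + 1)) (by simp [hleft, hj, Nat.le_of_lt hj])
        (by simp [hright, hj, Nat.le_of_lt hj]) (fun i hi => hV i hi j hj)
      have hcross : ∑ i ∈ Finset.range n, (χ (i + 1) j - χ i j) * (κ i (j + 1) - κ i j) = 0 :=
        Finset.sum_eq_zero fun i hi => hH i (Finset.mem_range.1 hi) j hj
      rw [← ih (Nat.le_of_lt hj), ← sub_eq_zero, ← Finset.sum_sub_distrib, ← add_zero (0 : ℤ)]
      nth_rw 2 [← hparts]
      rw [← hcross, ← Finset.sum_add_distrib]
      exact Finset.sum_congr rfl fun i _ => by ring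
  have := key m le_rfl
  rw [Finset.sum_eq_zero fun i hi => by rw [htop i (Finset.mem_range.1 hi), mul_zero]] at this
  norm_num at this

/-- If a square has no open horizontal crossing, the dual configuration of closed bonds has a
vertical crossing of it. -/
theorem mem_hCross_or_dual_mem_vCross (n : ℕ) (a b : ℤ) (ω : PercCfg) :
    ω ∈ HCross a (a + n) b (b + n) ∨
      relabel dualBond Equiv.boolNot ω ∈ VCross a (a + n) b (b + n) := by
  classical
  by_contra! hcon
  obtain ⟨hno, hno'⟩ := hcon
  set ω' := relabel dualBond Equiv.boolNot ω with hω'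
  let L : ℕ → ℕ → Prop := fun i j =>
    OpenReach ω a (a + n) b (b + n) {v | v.1 = a} (a + i, b + j)
  let K : ℕ → ℕ → Prop := fun i j =>
    OpenReach ω' a (a + n) b (b + n) {v | v.2 = b} (a + i, b + j)
  have hrect : ∀ i ≤ n, ∀ j ≤ n, InRect a (a + n) b (b + n) ((a + i, b + j) : ℤ × ℤ) := by
    intro i hi j hj
    simp only [InRect]
    omega
  refine false_of_jumps_disjoint (n := n) (m := n) (χ := fun i j => if L i j then 1 else 0)
    (κ := fun i j => if K i j then 1 else 0) ?_ ?_ ?_ ?_ ?_ ?_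
  · exact fun j hj => if_pos (OpenReach.of_mem (by simp) (hrect 0 n.zero_le j hj))
  · refine fun j hj => if_neg ?_
    rintro ⟨k, p, hp, h0, hk⟩
    exact hno ⟨k, p, hp, h0, by rw [hk]⟩
  · exact fun i hi => if_pos (OpenReach.of_mem (by simp) (hrect i hi.le 0 n.zero_le))
  · refine fun i hi => if_neg ?_
    rintro ⟨k, p, hp, h0, hk⟩
    exact hno' ⟨k, p, hp, h0, by rw [hk]⟩
  · intro i hi j hj
    rcases hopen : ω ((a + i, b + j), true) with _ | _
    · have hK : K i j ↔ K i (j + 1) := by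
        refine openReach_congr ?_ (hrect _ hi.le _ hj.le) (hrect _ hi.le _ hj)
        refine Or.inr (Or.inr (Or.inl ⟨by simp [add_assoc], ?_⟩))
        simp [hω', relabel_apply, dualBond, hopen]
      simp [hK]
    · have hL : L i j ↔ L (i + 1) j :=
        openReach_congr (Or.inl ⟨by simp [add_assoc], hopen⟩) (hrect _ hi.le _ hj.le)
          (hrect _ hi _ hj.le)
      simp [hL]
  · intro i hi j hj
    rcases hopen : ω ((a + (i + 1 : ℕ), b + j), false) with _ | _
    · have hK : K i (j + 1) ↔ K (i + 1) (j + 1) := by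
        refine openReach_congr ?_ (hrect _ (by omega) _ hj) (hrect _ hi.le _ hj)
        refine Or.inl ⟨by simp [add_assoc], ?_⟩
        rw [Nat.cast_succ, ← add_assoc] at hopen
        simp [hω', relabel_apply, dualBond, ← add_assoc, hopen]
      simp [hK]
    · have hL : L (i + 1) j ↔ L (i + 1) (j + 1) :=
        openReach_congr (Or.inr (Or.inr (Or.inl ⟨by simp [add_assoc], hopen⟩)))
          (hrect _ hi.le _ hj.le) (hrect _ hi.le _ hj)
      simp [hL]

/-- **Square-crossing lemma for critical bond percolation on `ℤ²`** (Lemma 5.1):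
there is `c₁ > 0` such that every square `[a, a+n] × [b, b+n]` satisfies
`Pr(H(S)) = Pr(V(S)) ≥ c₁`. -/
theorem square_crossing_Z2 :
    ∃ c1 : ENNReal, 0 < c1 ∧
      ∀ Pr : Measure PercCfg, IsBondPerc Pr →
        ∀ (n : ℕ), 1 ≤ n → ∀ a b : ℤ,
          Pr (HCross a (a + n) b (b + n)) = Pr (VCross a (a + n) b (b + n)) ∧
          c1 ≤ Pr (HCross a (a + n) b (b + n)) := by
  refine ⟨1 / 2, by simp, fun Pr hPr n _ a b => ?_⟩
  have := hPr.1
  have hHV : Pr (HCross a (a + n) b (b + n)) = Pr (VCross a (a + n) b (b + n)) := by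
    rw [← preimage_relabel_reflectBond_hCross, hPr.measure_preimage_relabel]
  refine ⟨hHV, ENNReal.div_le_of_le_mul ?_⟩
  calc (1 : ENNReal) = Pr Set.univ := measure_univ.symm
    _ ≤ Pr (HCross a (a + n) b (b + n) ∪
          relabel dualBond Equiv.boolNot ⁻¹' VCross a (a + n) b (b + n)) :=
        measure_mono fun ω _ => mem_hCross_or_dual_mem_vCross n a b ω
    _ ≤ Pr (HCross a (a + n) b (b + n)) +
          Pr (relabel dualBond Equiv.boolNot ⁻¹' VCross a (a + n) b (b + n)) :=
        measure_union_le _ _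
    _ = Pr (HCross a (a + n) b (b + n)) * 2 := by
        rw [hPr.measure_preimage_relabel, ← hHV, mul_two]
end
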